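/- For every s < 1/2 there is C > 0 such that for all t ∈ ℝ and all v, w : ℤ → ℂ with ‖v‖_{H^{1/2}}, ‖w‖_{H^{1/2}} < ∞: ‖N₂(v)(t)‖_{H^s} ≤ C ‖v‖⁵_{H^{1/2}}, and ‖N₂(v)(t) − N₂(w)(t)‖_{H^s} ≤ C (‖v‖_{H^{1/2}} + ‖w‖_{H^{1/2}})⁴ ‖v − w‖_{H^{1/2}}. -/

import Mathlib

open scoped ENNReal

/-- Japanese bracket `⟨k⟩ = 1 + |k|`. -/
noncomputable def jb (k : ℤ) : ℝ := 1 + |(k : ℝ)|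

/-- `‖f‖_{H^s} = (∑_k ⟨k⟩^{2s} |f k|²)^{1/2}`, valued in `[0,∞]`. -/
noncomputable def hnorm (s : ℝ) (f : ℤ → ℂ) : ℝ≥0∞ :=
  (∑' k : ℤ, ENNReal.ofReal (jb k ^ (2 * s) * ‖f k‖ ^ 2)) ^ (1 / 2 : ℝ)

/-- `Φ(k̄) = k³ − k₁³ − k₂³ − k₃³` with `k = k₁ + k₂ + k₃`. -/
def Phi (k₁ k₂ k₃ : ℤ) : ℤ := (k₁ + k₂ + k₃) ^ 3 - k₁ ^ 3 - k₂ ^ 3 - k₃ ^ 3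

/-- Cubic summand of `N₂(v)(t)_k`, parametrized by `(k₁, k₂)` with `k₃ = k - k₁ - k₂`. -/
noncomputable def N2term1 (v : ℤ → ℂ) (t : ℝ) (k : ℤ) (p : ℤ × ℤ) : ℂ :=
  if Phi p.1 p.2 (k - p.1 - p.2) ≠ 0 then
    -(((k : ℂ) * (p.1 : ℂ)) / (Complex.I * ((Phi p.1 p.2 (k - p.1 - p.2) : ℤ) : ℂ))) *
      Complex.exp (Complex.I * (t : ℂ) * ((Phi p.1 p.2 (k - p.1 - p.2) : ℤ) : ℂ)) *
      (‖v p.1‖ : ℂ) ^ 2 * v p.1 * v p.2 * v (k - p.1 - p.2)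
  else 0

/-- Quintic summand of `N₂(v)(t)_k`, parametrized by `(k₁, k₂, j₁, j₂)` with
`k₃ = k - k₁ - k₂` and `j₃ = k₁ - j₁ - j₂`. -/
noncomputable def N2term2 (v : ℤ → ℂ) (t : ℝ) (k : ℤ) (q : ℤ × ℤ × ℤ × ℤ) : ℂ :=
  if Phi q.1 q.2.1 (k - q.1 - q.2.1) ≠ 0 ∧
      Phi q.2.2.1 q.2.2.2 (q.1 - q.2.2.1 - q.2.2.2) ≠ 0 then
    (1 / 3 : ℂ) *
      (((k : ℂ) * (q.1 : ℂ)) / (Complex.I * ((Phi q.1 q.2.1 (k - q.1 - q.2.1) : ℤ) : ℂ))) *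
      Complex.exp (Complex.I * (t : ℂ) *
        (((Phi q.1 q.2.1 (k - q.1 - q.2.1) : ℤ) : ℂ) +
          ((Phi q.2.2.1 q.2.2.2 (q.1 - q.2.2.1 - q.2.2.2) : ℤ) : ℂ))) *
      v q.2.2.1 * v q.2.2.2 * v (q.1 - q.2.2.1 - q.2.2.2) * v q.2.1 * v (k - q.1 - q.2.1)
  else 0

/-- `N₂(v)(t)_k`, arising from differentiation by parts. -/
noncomputable def N2 (v : ℤ → ℂ) (t : ℝ) (k : ℤ) : ℂ :=
  (∑' p : ℤ × ℤ, N2term1 v t k p) + ∑' q : ℤ × ℤ × ℤ × ℤ, N2term2 v t k q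

theorem one_le_jb (k : ℤ) : 1 ≤ jb k := by
  unfold jb; linarith [abs_nonneg (k : ℝ)]

theorem jb_pos (k : ℤ) : 0 < jb k := zero_lt_one.trans_le (one_le_jb k)

theorem jb_neg (k : ℤ) : jb (-k) = jb k := by simp [jb]

theorem jb_add_le (k l : ℤ) : jb (k + l) ≤ jb k + jb l - 1 := by
  unfold jb; push_cast; linarith [abs_add_le (k : ℝ) l]

theorem jb_add_le_mul (k l : ℤ) : jb (k + l) ≤ jb k * jb l := by
  nlinarith [jb_add_le k l, one_le_jb k, one_le_jb l]

theorem jb_le_two_mul_abs {k : ℤ} (hk : k ≠ 0) : jb k ≤ 2 * |(k : ℝ)| := by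
  have : (1 : ℝ) ≤ |(k : ℝ)| := by exact_mod_cast Int.one_le_abs hk
  unfold jb; linarith

theorem two_mul_jb (k : ℤ) : jb (2 * k) = 2 * jb k - 1 := by
  simp [jb, abs_mul]; ring

theorem summable_jb_rpow {p : ℝ} (hp : 1 < p) : Summable fun n : ℤ => jb n ^ (-p) := by
  refine Summable.of_norm_bounded_eventually (Real.summable_abs_int_rpow hp) ?_
  refine (Filter.eventually_cofinite_ne 0).mono fun n hn => ?_
  have hn' : 0 < |(n : ℝ)| := by positivity
  rw [Real.norm_of_nonneg (by have := jb_pos n; positivity)]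
  exact Real.rpow_le_rpow_of_nonpos hn' (by unfold jb; linarith) (by linarith)

theorem tsum_jb_rpow_lt_top {p : ℝ} (hp : 1 < p) :
    ∑' n : ℤ, ENNReal.ofReal (jb n ^ (-p)) < ⊤ :=
  (summable_jb_rpow hp).tsum_ofReal_lt_top

/-- A double sum of `⟨α⟩^{-p} ⟨β⟩^{-p}` along injective coordinates `(α, β)`. -/
theorem tsum_jb_pair_le (p : ℝ) (φ : ℤ × ℤ → ℤ × ℤ) (hφ : Function.Injective φ) :
    ∑' x, ENNReal.ofReal (jb (φ x).1 ^ (-p) * jb (φ x).2 ^ (-p)) ≤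
      (∑' n : ℤ, ENNReal.ofReal (jb n ^ (-p))) ^ 2 := by
  refine (ENNReal.tsum_comp_le_tsum_of_injective hφ
    fun y => ENNReal.ofReal (jb y.1 ^ (-p) * jb y.2 ^ (-p))).trans_eq ?_
  rw [ENNReal.tsum_prod', sq, ← ENNReal.tsum_mul_right]
  refine tsum_congr fun a => ?_
  rw [← ENNReal.tsum_mul_left]
  refine tsum_congr fun b => ?_
  have := jb_pos a
  rw [ENNReal.ofReal_mul (by positivity)]

theorem rpow_div_mul_le {τ X x y z : ℝ} (h0 : 0 ≤ τ) (h1 : τ ≤ 1) (hX : 1 ≤ X) (hx : 1 ≤ x)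
    (hy : 1 ≤ y) (hxz : x ≤ z) (hyz : y ≤ z) (hXz : X ≤ 3 * z) :
    X ^ τ / (x * y * z) ≤ 3 * (x ^ (-((3 - τ) / 2)) * y ^ (-((3 - τ) / 2))) := by
  have hx0 : 0 < x := by linarith
  have hy0 : 0 < y := by linarith
  have hz0 : 0 < z := by linarith
  have e1 : X ^ τ ≤ 3 * z ^ τ := by
    calc X ^ τ ≤ (3 * z) ^ τ := Real.rpow_le_rpow (by linarith) hXz h0
      _ = 3 ^ τ * z ^ τ := Real.mul_rpow (by norm_num) hz0.le
      _ ≤ 3 * z ^ τ := by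
        gcongr
        simpa using Real.rpow_le_rpow_of_exponent_le (x := 3) (by norm_num) h1
  have e2 : z ^ τ / z ≤ x ^ ((τ - 1) / 2) * y ^ ((τ - 1) / 2) := by
    have : z ^ τ / z = z ^ ((τ - 1) / 2) * z ^ ((τ - 1) / 2) := by
      rw [← Real.rpow_add hz0, ← Real.rpow_sub_one hz0.ne']; congr 1; ring
    rw [this]
    gcongr ?_ * ?_
    · exact Real.rpow_le_rpow_of_nonpos hx0 hxz (by linarith)
    · exact Real.rpow_le_rpow_of_nonpos hy0 hyz (by linarith)
  have e3 : ∀ r : ℝ, 0 < r → r ^ (-((3 - τ) / 2)) = r ^ ((τ - 1) / 2) / r := by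
    intro r hr
    rw [← Real.rpow_sub_one hr.ne']; congr 1; ring
  rw [e3 x hx0, e3 y hy0]
  calc X ^ τ / (x * y * z) ≤ 3 * z ^ τ / (x * y * z) := by gcongr
    _ = 3 * (z ^ τ / z) / (x * y) := by field_simp
    _ ≤ 3 * (x ^ ((τ - 1) / 2) * y ^ ((τ - 1) / 2)) / (x * y) := by gcongr
    _ = _ := by field_simp

theorem rpow_div_mul_le_sum {τ X x y z : ℝ} (h0 : 0 ≤ τ) (h1 : τ ≤ 1) (hX : 1 ≤ X) (hx : 1 ≤ x)
    (hy : 1 ≤ y) (hz : 1 ≤ z) (hXs : X ≤ x + y + z) {p : ℝ} (hp : p = (3 - τ) / 2) :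
    1 / (x * y * z) ≤
      3 * (x ^ (-p) * y ^ (-p) + y ^ (-p) * z ^ (-p) + x ^ (-p) * z ^ (-p)) * X ^ (-τ) := by
  subst hp
  have hx0 : 0 < x := by linarith
  have hy0 : 0 < y := by linarith
  have hz0 : 0 < z := by linarith
  have hX0 : 0 < X := by linarith
  have p1 : 0 ≤ x ^ (-((3 - τ) / 2)) * y ^ (-((3 - τ) / 2)) := by positivity
  have p2 : 0 ≤ y ^ (-((3 - τ) / 2)) * z ^ (-((3 - τ) / 2)) := by positivity
  have p3 : 0 ≤ x ^ (-((3 - τ) / 2)) * z ^ (-((3 - τ) / 2)) := by positivity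
  rw [Real.rpow_neg hX0.le τ, ← div_eq_mul_inv, le_div_iff₀ (by positivity), div_mul_eq_mul_div,
    one_mul]
  rcases le_total x y with hxy | hxy <;> rcases le_total y z with hyz | hyz <;>
    rcases le_total x z with hxz | hxz
  all_goals first
    | linarith [rpow_div_mul_le (z := z) h0 h1 hX hx hy (by linarith) (by linarith) (by linarith)]
    | (have := rpow_div_mul_le (z := x) h0 h1 hX hy hz (by linarith) (by linarith) (by linarith)
       rw [show y * z * x = x * y * z by ring] at this; linarith)
    | (have := rpow_div_mul_le (z := y) h0 h1 hX hx hz (by linarith) (by linarith) (by linarith)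
       rw [show x * z * y = x * y * z by ring] at this; linarith)

theorem tsum_inner_le {τ p : ℝ} (h0 : 0 ≤ τ) (h1 : τ ≤ 1) (hp : p = (3 - τ) / 2) (k : ℤ) :
    ∑' j : ℤ × ℤ, ENNReal.ofReal (1 / (jb j.1 * jb j.2 * jb (k - j.1 - j.2))) ≤
      9 * (∑' n : ℤ, ENNReal.ofReal (jb n ^ (-p))) ^ 2 * ENNReal.ofReal (jb k ^ (-τ)) := by
  set S := (∑' n : ℤ, ENNReal.ofReal (jb n ^ (-p))) ^ 2
  have hk := jb_pos k
  calc ∑' j : ℤ × ℤ, ENNReal.ofReal (1 / (jb j.1 * jb j.2 * jb (k - j.1 - j.2)))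
      ≤ ∑' j : ℤ × ℤ, 3 * (ENNReal.ofReal (jb j.1 ^ (-p) * jb j.2 ^ (-p)) +
          ENNReal.ofReal (jb j.2 ^ (-p) * jb (k - j.1 - j.2) ^ (-p)) +
          ENNReal.ofReal (jb j.1 ^ (-p) * jb (k - j.1 - j.2) ^ (-p))) *
          ENNReal.ofReal (jb k ^ (-τ)) := by
        refine ENNReal.tsum_le_tsum fun j => ?_
        have a1 := jb_pos j.1
        have a2 := jb_pos j.2
        have a3 := jb_pos (k - j.1 - j.2)
        rw [← ENNReal.ofReal_add (by positivity) (by positivity),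
          ← ENNReal.ofReal_add (by positivity) (by positivity),
          show (3 : ℝ≥0∞) = ENNReal.ofReal 3 by simp,
          ← ENNReal.ofReal_mul (by positivity), ← ENNReal.ofReal_mul (by positivity)]
        refine ENNReal.ofReal_le_ofReal (rpow_div_mul_le_sum h0 h1 (one_le_jb _) (one_le_jb _)
          (one_le_jb _) (one_le_jb _) ?_ hp)
        have e1 := jb_add_le (j.1 + j.2) (k - j.1 - j.2)
        have e2 := jb_add_le j.1 j.2
        rw [show j.1 + j.2 + (k - j.1 - j.2) = k by ring] at e1
        linarith
    _ ≤ 3 * (S + S + S) * ENNReal.ofReal (jb k ^ (-τ)) := by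
        rw [ENNReal.tsum_mul_right, ENNReal.tsum_mul_left, ENNReal.tsum_add, ENNReal.tsum_add]
        gcongr
        · exact tsum_jb_pair_le p (fun j => j) (fun _ _ h => h)
        · refine tsum_jb_pair_le p (fun j => (j.2, k - j.1 - j.2)) ?_
          rintro ⟨a, b⟩ ⟨c, d⟩ h
          simp only [Prod.mk.injEq] at h ⊢; omega
        · refine tsum_jb_pair_le p (fun j => (j.1, k - j.1 - j.2)) ?_
          rintro ⟨a, b⟩ ⟨c, d⟩ h
          simp only [Prod.mk.injEq] at h ⊢; omega
    _ = 9 * S * ENNReal.ofReal (jb k ^ (-τ)) := by ring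

/-- The multiplier `|k k₁ / Φ(k̄)|`, extended by zero to the resonant set. -/
noncomputable def resMult (k k₁ k₂ : ℤ) : ℝ :=
  if Phi k₁ k₂ (k - k₁ - k₂) ≠ 0 then
    |(k : ℝ) * k₁| / |((Phi k₁ k₂ (k - k₁ - k₂) : ℤ) : ℝ)| else 0

theorem Phi_eq (k₁ k₂ k₃ : ℤ) :
    Phi k₁ k₂ k₃ = 3 * ((k₂ + k₃) * (k₁ + k₃) * (k₁ + k₂)) := by
  unfold Phi; ring

theorem rpow_mul_div_sq_le {τ p K X Y Z A B C : ℝ} (h0 : 0 ≤ τ) (h1 : τ ≤ 1) (hp : p ≤ 2 - τ)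
    (hK : 1 ≤ K) (hX : 1 ≤ X) (hY : 1 ≤ Y) (hZ : 1 ≤ Z) (hA : 1 ≤ A) (hB : 1 ≤ B) (hC : 1 ≤ C)
    (hKA : K ≤ 3 * A) (hYA : Y ≤ 3 * A) (hZA : Z ≤ 3 * A) (hAX : A ≤ 2 * (X * B * C)) :
    K ^ τ * X ^ (-τ) * (Y * Z) / (A * B * C) ^ 2 ≤ 54 * (B ^ (-p) * C ^ (-p)) := by
  have hK0 : 0 < K := by linarith
  have hX0 : 0 < X := by linarith
  have hA0 : 0 < A := by linarith
  have hB0 : 0 < B := by linarith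
  have hC0 : 0 < C := by linarith
  have e1 : K ^ τ * X ^ (-τ) ≤ 6 * (B ^ τ * C ^ τ) := by
    calc K ^ τ * X ^ (-τ) = (K / X) ^ τ := by
          rw [Real.rpow_neg hX0.le, ← div_eq_mul_inv, Real.div_rpow hK0.le hX0.le]
      _ ≤ (6 * (B * C)) ^ τ := by
          refine Real.rpow_le_rpow (by positivity) ?_ h0
          rw [div_le_iff₀ hX0]; linarith
      _ = 6 ^ τ * (B ^ τ * C ^ τ) := by
          rw [Real.mul_rpow (by norm_num) (by positivity), Real.mul_rpow hB0.le hC0.le]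
      _ ≤ 6 * (B ^ τ * C ^ τ) := by
          gcongr
          simpa using Real.rpow_le_rpow_of_exponent_le (x := 6) (by norm_num) h1
  have e2 : Y * Z ≤ 9 * A ^ 2 := by nlinarith
  have e3 : ∀ r : ℝ, 1 ≤ r → r ^ τ / r ^ 2 ≤ r ^ (-p) := by
    intro r hr
    rw [← Real.rpow_two, ← Real.rpow_sub (by linarith)]
    exact Real.rpow_le_rpow_of_exponent_le hr (by linarith)
  calc K ^ τ * X ^ (-τ) * (Y * Z) / (A * B * C) ^ 2
      ≤ 6 * (B ^ τ * C ^ τ) * (9 * A ^ 2) / (A * B * C) ^ 2 := by gcongr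
    _ = 54 * ((B ^ τ / B ^ 2) * (C ^ τ / C ^ 2)) := by field_simp; ring
    _ ≤ 54 * (B ^ (-p) * C ^ (-p)) := by
        gcongr ?_ * (?_ * ?_)
        · exact e3 B hB
        · exact e3 C hC

theorem rpow_div_sq_div_le {τ p K X Y Z A : ℝ} (h0 : 0 ≤ τ) (hp : p ≤ 2 - τ)
    (hK : 1 ≤ K) (hX : 1 ≤ X) (hY : 1 ≤ Y) (hZ : 1 ≤ Z) (hA : 1 ≤ A) (hKA : K ≤ X * A) :
    K ^ τ * X ^ (-τ) / A ^ 2 / (Y * Z) ≤ A ^ (-p) * Y ^ (-p) + A ^ (-p) * Z ^ (-p) := by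
  have hX0 : 0 < X := by linarith
  have hY0 : 0 < Y := by linarith
  have hZ0 : 0 < Z := by linarith
  have hA0 : 0 < A := by linarith
  have e1 : K ^ τ * X ^ (-τ) / A ^ 2 ≤ A ^ (-p) := by
    calc K ^ τ * X ^ (-τ) / A ^ 2 ≤ (X * A) ^ τ * X ^ (-τ) / A ^ 2 := by gcongr
      _ = A ^ τ / A ^ 2 := by
        rw [Real.mul_rpow hX0.le hA0.le, Real.rpow_neg hX0.le]; field_simp
      _ ≤ A ^ (-p) := by
        rw [← Real.rpow_two, ← Real.rpow_sub hA0]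
        exact Real.rpow_le_rpow_of_exponent_le hA (by linarith)
  have e3 : ∀ r : ℝ, 1 ≤ r → (1 / r) ^ 2 ≤ r ^ (-p) := by
    intro r hr
    have : (1 / r) ^ 2 = r ^ (-2 : ℝ) := by
      rw [Real.rpow_neg (by linarith), Real.rpow_two]; simp
    rw [this]
    exact Real.rpow_le_rpow_of_exponent_le hr (by linarith)
  have e2 : 1 / (Y * Z) ≤ Y ^ (-p) + Z ^ (-p) := by
    have := e3 Y hY
    have := e3 Z hZ
    have h : 1 / (Y * Z) = 1 / Y * (1 / Z) := by field_simp
    rw [h]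
    nlinarith [sq_nonneg (1 / Y - 1 / Z), sq_nonneg (1 / Y), sq_nonneg (1 / Z)]
  calc K ^ τ * X ^ (-τ) / A ^ 2 / (Y * Z) = K ^ τ * X ^ (-τ) / A ^ 2 * (1 / (Y * Z)) := by
        field_simp
    _ ≤ A ^ (-p) * (Y ^ (-p) + Z ^ (-p)) := by gcongr
    _ = _ := by ring

theorem resMult_nonneg (k k₁ k₂ : ℤ) : 0 ≤ resMult k k₁ k₂ := by
  unfold resMult; split_ifs <;> positivity

theorem resMult_sq_le {k₁ k₂ k₃ : ℤ} (ha : k₂ + k₃ ≠ 0) (hb : k₁ + k₃ ≠ 0) (hc : k₁ + k₂ ≠ 0) :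
    resMult (k₁ + k₂ + k₃) k₁ k₂ ^ 2 ≤ 8 / jb (k₂ + k₃) ^ 2 +
      128 * (jb k₂ * jb k₃) ^ 2 / (jb (k₂ + k₃) * jb (k₁ + k₃) * jb (k₁ + k₂)) ^ 2 := by
  have hA := jb_pos (k₂ + k₃)
  have hB := jb_pos (k₁ + k₃)
  have hC := jb_pos (k₁ + k₂)
  have hA' := jb_le_two_mul_abs ha
  have hB' := jb_le_two_mul_abs hb
  have hC' := jb_le_two_mul_abs hc
  have habs : ∀ l : ℤ, |(l : ℝ)| ≤ jb l := fun l => by unfold jb; linarith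
  have hid : ((k₁ + k₂ + k₃ : ℤ) : ℝ) * k₁ =
      ((k₁ + k₃ : ℤ) : ℝ) * ((k₁ + k₂ : ℤ) : ℝ) - (k₂ : ℝ) * k₃ := by push_cast; ring
  have hphi : Phi k₁ k₂ (k₁ + k₂ + k₃ - k₁ - k₂) ≠ 0 := by
    rw [show k₁ + k₂ + k₃ - k₁ - k₂ = k₃ by ring, Phi_eq]
    simp [ha, hb, hc]
  have key : resMult (k₁ + k₂ + k₃) k₁ k₂ ≤ 2 / jb (k₂ + k₃) +
      8 * (jb k₂ * jb k₃) / (jb (k₂ + k₃) * jb (k₁ + k₃) * jb (k₁ + k₂)) := by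
    unfold resMult
    rw [if_pos hphi, show k₁ + k₂ + k₃ - k₁ - k₂ = k₃ by ring, Phi_eq, hid]
    rw [Int.cast_mul, Int.cast_mul, Int.cast_mul, abs_mul, abs_mul, abs_mul]
    have hn : |((k₁ + k₃ : ℤ) : ℝ) * ((k₁ + k₂ : ℤ) : ℝ) - (k₂ : ℝ) * k₃| ≤
        |((k₁ + k₃ : ℤ) : ℝ)| * |((k₁ + k₂ : ℤ) : ℝ)| + jb k₂ * jb k₃ := by
      refine (abs_sub _ _).trans ?_
      rw [abs_mul, abs_mul]
      gcongr
      all_goals first | exact habs _ | exact (jb_pos _).le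
    have hYZ : 0 < jb k₂ * jb k₃ := mul_pos (jb_pos _) (jb_pos _)
    generalize |((k₂ + k₃ : ℤ) : ℝ)| = a at *
    generalize |((k₁ + k₃ : ℤ) : ℝ)| = b at *
    generalize |((k₁ + k₂ : ℤ) : ℝ)| = c at *
    have ha0 : 0 < a := by linarith
    have hb0 : 0 < b := by linarith
    have hc0 : 0 < c := by linarith
    have h3 : a * b * c ≤ |((3 : ℤ) : ℝ)| * (a * b * c) := by
      have : 0 < a * b * c := by positivity
      norm_num; linarith
    calc _ ≤ (b * c + jb k₂ * jb k₃) / (a * b * c) := by gcongr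
      _ = 2 / (2 * a) + 8 * (jb k₂ * jb k₃) / ((2 * a) * (2 * b) * (2 * c)) := by
        field_simp; ring
      _ ≤ _ := by gcongr
  calc resMult (k₁ + k₂ + k₃) k₁ k₂ ^ 2 ≤ (2 / jb (k₂ + k₃) +
      8 * (jb k₂ * jb k₃) / (jb (k₂ + k₃) * jb (k₁ + k₃) * jb (k₁ + k₂))) ^ 2 :=
        pow_le_pow_left₀ (resMult_nonneg _ _ _) key 2
    _ ≤ 2 * ((2 / jb (k₂ + k₃)) ^ 2 +
      (8 * (jb k₂ * jb k₃) / (jb (k₂ + k₃) * jb (k₁ + k₃) * jb (k₁ + k₂))) ^ 2) := add_sq_le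
    _ = _ := by ring

theorem resMult_weight_le {τ p : ℝ} (h0 : 0 ≤ τ) (h1 : τ ≤ 1) (hp : p = (3 - τ) / 2)
    (k₁ k₂ k₃ : ℤ) :
    jb (k₁ + k₂ + k₃) ^ τ * resMult (k₁ + k₂ + k₃) k₁ k₂ ^ 2 * jb k₁ ^ (-τ) / (jb k₂ * jb k₃) ≤
      6912 * (jb (k₂ + k₃) ^ (-p) * jb k₂ ^ (-p) + jb (k₂ + k₃) ^ (-p) * jb k₃ ^ (-p) +
        jb (k₁ + k₃) ^ (-p) * jb (k₁ + k₂) ^ (-p) + jb (k₂ + k₃) ^ (-p) * jb (k₁ + k₂) ^ (-p) +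
        jb (k₂ + k₃) ^ (-p) * jb (k₁ + k₃) ^ (-p)) := by
  have hK := jb_pos (k₁ + k₂ + k₃)
  have hX := jb_pos k₁
  have hY := jb_pos k₂
  have hZ := jb_pos k₃
  have hA := jb_pos (k₂ + k₃)
  have hB := jb_pos (k₁ + k₃)
  have hC := jb_pos (k₁ + k₂)
  by_cases hphi : Phi k₁ k₂ (k₁ + k₂ + k₃ - k₁ - k₂) = 0
  · have : resMult (k₁ + k₂ + k₃) k₁ k₂ = 0 := by simp [resMult, hphi]
    rw [this]
    simp only [ne_eq, OfNat.ofNat_ne_zero, not_false_eq_true, zero_pow, mul_zero, zero_mul,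
      zero_div]
    positivity
  rw [show k₁ + k₂ + k₃ - k₁ - k₂ = k₃ by ring, Phi_eq] at hphi
  simp only [mul_eq_zero, not_or] at hphi
  obtain ⟨-, ⟨ha, hb⟩, hc⟩ := hphi
  have hM := resMult_sq_le ha hb hc
  have t1 := rpow_div_sq_div_le (τ := τ) (p := p) h0 (by linarith)
    (one_le_jb (k₁ + k₂ + k₃)) (one_le_jb k₁) (one_le_jb k₂) (one_le_jb k₃) (one_le_jb (k₂ + k₃))
    (by rw [add_assoc]; exact jb_add_le_mul _ _)
  have t2 : jb (k₁ + k₂ + k₃) ^ τ * jb k₁ ^ (-τ) * (jb k₂ * jb k₃) /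
      (jb (k₂ + k₃) * jb (k₁ + k₃) * jb (k₁ + k₂)) ^ 2 ≤
      54 * (jb (k₁ + k₃) ^ (-p) * jb (k₁ + k₂) ^ (-p) +
        jb (k₂ + k₃) ^ (-p) * jb (k₁ + k₂) ^ (-p) +
        jb (k₂ + k₃) ^ (-p) * jb (k₁ + k₃) ^ (-p)) := by
    have p1 : 0 ≤ jb (k₁ + k₃) ^ (-p) * jb (k₁ + k₂) ^ (-p) := by positivity
    have p2 : 0 ≤ jb (k₂ + k₃) ^ (-p) * jb (k₁ + k₂) ^ (-p) := by positivity
    have p3 : 0 ≤ jb (k₂ + k₃) ^ (-p) * jb (k₁ + k₃) ^ (-p) := by positivity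
    have q1 : 2 * jb (k₁ + k₂ + k₃) ≤ jb (k₂ + k₃) + jb (k₁ + k₃) + jb (k₁ + k₂) := by
      have := two_mul_jb (k₁ + k₂ + k₃)
      have := jb_add_le (k₂ + k₃ + (k₁ + k₃)) (k₁ + k₂)
      have := jb_add_le (k₂ + k₃) (k₁ + k₃)
      rw [show k₂ + k₃ + (k₁ + k₃) + (k₁ + k₂) = 2 * (k₁ + k₂ + k₃) by ring] at *
      linarith
    have q (a b c m : ℤ) (h : a + b - c = 2 * m) : 2 * jb m ≤ jb a + jb b + jb c := by
      have := two_mul_jb m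
      have := jb_add_le (a + b) (-c)
      have := jb_add_le a b
      rw [← sub_eq_add_neg, h, jb_neg] at *
      linarith
    have q2 := q (k₂ + k₃) (k₁ + k₂) (k₁ + k₃) k₂ (by ring)
    have q3 := q (k₂ + k₃) (k₁ + k₃) (k₁ + k₂) k₃ (by ring)
    have r (a b c m : ℤ) (h : 2 * m + b + c = a) : jb a ≤ 2 * (jb m * jb b * jb c) := by
      have h1 := jb_add_le_mul (2 * m + b) c
      have h2 := jb_add_le_mul (2 * m) b
      have h3 := two_mul_jb m
      rw [h] at h1
      have := jb_pos b
      have := jb_pos c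
      calc jb a ≤ jb (2 * m + b) * jb c := h1
        _ ≤ (2 * jb m * jb b) * jb c := by
          gcongr
          exact h2.trans (by gcongr; linarith)
        _ = _ := by ring
    have r1 : jb (k₂ + k₃) ≤ 2 * (jb k₁ * jb (k₁ + k₃) * jb (k₁ + k₂)) := by
      have := r (-(k₂ + k₃)) (-(k₁ + k₃)) (-(k₁ + k₂)) k₁ (by ring)
      simpa only [jb_neg] using this
    have r2 : jb (k₁ + k₃) ≤ 2 * (jb k₁ * jb (k₂ + k₃) * jb (k₁ + k₂)) := by
      have := r (k₁ + k₃) (k₂ + k₃) (-(k₁ + k₂)) k₁ (by ring)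
      simpa only [jb_neg] using this
    have r3 : jb (k₁ + k₂) ≤ 2 * (jb k₁ * jb (k₂ + k₃) * jb (k₁ + k₃)) := by
      have := r (k₁ + k₂) (k₂ + k₃) (-(k₁ + k₃)) k₁ (by ring)
      simpa only [jb_neg] using this
    have g1 := one_le_jb (k₁ + k₂ + k₃)
    have g2 := one_le_jb k₁
    have g3 := one_le_jb k₂
    have g4 := one_le_jb k₃
    have g5 := one_le_jb (k₂ + k₃)
    have g6 := one_le_jb (k₁ + k₃)
    have g7 := one_le_jb (k₁ + k₂)
    have hp' : p ≤ 2 - τ := by linarith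
    by_cases c1 : jb (k₁ + k₃) ≤ jb (k₂ + k₃) ∧ jb (k₁ + k₂) ≤ jb (k₂ + k₃)
    · have := rpow_mul_div_sq_le h0 h1 hp' g1 g2 g3 g4 g5 g6 g7 (by linarith) (by linarith)
        (by linarith) r1
      linarith
    by_cases c2 : jb (k₂ + k₃) ≤ jb (k₁ + k₃) ∧ jb (k₁ + k₂) ≤ jb (k₁ + k₃)
    · have := rpow_mul_div_sq_le h0 h1 hp' g1 g2 g3 g4 g6 g5 g7 (by linarith) (by linarith)
        (by linarith) r2
      rw [mul_comm (jb (k₁ + k₃)) (jb (k₂ + k₃))] at this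
      linarith
    have c3 : jb (k₂ + k₃) ≤ jb (k₁ + k₂) ∧ jb (k₁ + k₃) ≤ jb (k₁ + k₂) := by
      grind
    have := rpow_mul_div_sq_le h0 h1 hp' g1 g2 g3 g4 g7 g5 g6 (by linarith) (by linarith)
      (by linarith) r3
    rw [show jb (k₁ + k₂) * jb (k₂ + k₃) * jb (k₁ + k₃) =
      jb (k₂ + k₃) * jb (k₁ + k₃) * jb (k₁ + k₂) by ring] at this
    linarith
  have p1 : 0 ≤ jb (k₂ + k₃) ^ (-p) * jb k₂ ^ (-p) + jb (k₂ + k₃) ^ (-p) * jb k₃ ^ (-p) := by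
    positivity
  calc jb (k₁ + k₂ + k₃) ^ τ * resMult (k₁ + k₂ + k₃) k₁ k₂ ^ 2 * jb k₁ ^ (-τ) / (jb k₂ * jb k₃)
      ≤ jb (k₁ + k₂ + k₃) ^ τ * (8 / jb (k₂ + k₃) ^ 2 +
        128 * (jb k₂ * jb k₃) ^ 2 / (jb (k₂ + k₃) * jb (k₁ + k₃) * jb (k₁ + k₂)) ^ 2) *
        jb k₁ ^ (-τ) / (jb k₂ * jb k₃) := by gcongr
    _ = 8 * (jb (k₁ + k₂ + k₃) ^ τ * jb k₁ ^ (-τ) / jb (k₂ + k₃) ^ 2 / (jb k₂ * jb k₃)) +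
        128 * (jb (k₁ + k₂ + k₃) ^ τ * jb k₁ ^ (-τ) * (jb k₂ * jb k₃) /
          (jb (k₂ + k₃) * jb (k₁ + k₃) * jb (k₁ + k₂)) ^ 2) := by
        generalize jb (k₁ + k₂ + k₃) ^ τ = P
        generalize jb k₁ ^ (-τ) = Q
        field_simp
    _ ≤ _ := by linarith

theorem tsum_resMult_le {τ p : ℝ} (h0 : 0 ≤ τ) (h1 : τ ≤ 1) (hp : p = (3 - τ) / 2) (k : ℤ) :
    ∑' q : ℤ × ℤ, ENNReal.ofReal
      (jb k ^ τ * resMult k q.1 q.2 ^ 2 * jb q.1 ^ (-τ) / (jb q.2 * jb (k - q.1 - q.2))) ≤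
      34560 * (∑' n : ℤ, ENNReal.ofReal (jb n ^ (-p))) ^ 2 := by
  set S := (∑' n : ℤ, ENNReal.ofReal (jb n ^ (-p))) ^ 2 with hS
  let E (x y : ℤ) : ℝ≥0∞ := ENNReal.ofReal (jb x ^ (-p) * jb y ^ (-p))
  have hE (φ : ℤ × ℤ → ℤ × ℤ) (hφ : Function.Injective φ) : ∑' x, E (φ x).1 (φ x).2 ≤ S :=
    tsum_jb_pair_le p φ hφ
  calc _ ≤ ∑' q : ℤ × ℤ, 6912 * (E (k - q.1) q.2 + E (k - q.1) (k - q.1 - q.2) +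
          E (k - q.2) (q.1 + q.2) + E (k - q.1) (q.1 + q.2) + E (k - q.1) (k - q.2)) := by
        refine ENNReal.tsum_le_tsum fun q => ?_
        have := resMult_weight_le h0 h1 hp q.1 q.2 (k - q.1 - q.2)
        rw [show q.1 + q.2 + (k - q.1 - q.2) = k by ring,
          show q.2 + (k - q.1 - q.2) = k - q.1 by ring,
          show q.1 + (k - q.1 - q.2) = k - q.2 by ring] at this
        have a1 := jb_pos q.2
        have a2 := jb_pos (k - q.1)
        have a3 := jb_pos (k - q.1 - q.2)
        have a4 := jb_pos (k - q.2)
        have a5 := jb_pos (q.1 + q.2)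
        simp only [E]
        rw [← ENNReal.ofReal_add (by positivity) (by positivity),
          ← ENNReal.ofReal_add (by positivity) (by positivity),
          ← ENNReal.ofReal_add (by positivity) (by positivity),
          ← ENNReal.ofReal_add (by positivity) (by positivity),
          show (6912 : ℝ≥0∞) = ENNReal.ofReal 6912 by simp,
          ← ENNReal.ofReal_mul (by positivity)]
        exact ENNReal.ofReal_le_ofReal this
    _ ≤ 6912 * (S + S + S + S + S) := by
        rw [ENNReal.tsum_mul_left, ENNReal.tsum_add, ENNReal.tsum_add, ENNReal.tsum_add,
          ENNReal.tsum_add]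
        gcongr
        · refine hE (fun q => (k - q.1, q.2)) ?_
          rintro ⟨a, b⟩ ⟨c, d⟩ h
          simp only [Prod.mk.injEq] at h ⊢; omega
        · refine hE (fun q => (k - q.1, k - q.1 - q.2)) ?_
          rintro ⟨a, b⟩ ⟨c, d⟩ h
          simp only [Prod.mk.injEq] at h ⊢; omega
        · refine hE (fun q => (k - q.2, q.1 + q.2)) ?_
          rintro ⟨a, b⟩ ⟨c, d⟩ h
          simp only [Prod.mk.injEq] at h ⊢; omega
        · refine hE (fun q => (k - q.1, q.1 + q.2)) ?_
          rintro ⟨a, b⟩ ⟨c, d⟩ h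
          simp only [Prod.mk.injEq] at h ⊢; omega
        · refine hE (fun q => (k - q.1, k - q.2)) ?_
          rintro ⟨a, b⟩ ⟨c, d⟩ h
          simp only [Prod.mk.injEq] at h ⊢; omega
    _ = 34560 * S := by ring

theorem ENNReal.tsum_mul_sq_le {ι : Type*} (f g : ι → ℝ≥0∞) :
    (∑' i, f i * g i) ^ 2 ≤ (∑' i, f i ^ 2) * ∑' i, g i ^ 2 := by
  let _ : MeasurableSpace ι := ⊤
  have hm : ∀ u : ι → ℝ≥0∞, Measurable u := fun _ => measurable_from_top
  have h := ENNReal.lintegral_mul_le_Lp_mul_Lq (MeasureTheory.Measure.count : MeasureTheory.Measure ι)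
    Real.HolderConjugate.two_two (hm f).aemeasurable (hm g).aemeasurable
  simp only [MeasureTheory.lintegral_count, Pi.mul_apply, ENNReal.rpow_two] at h
  have hsq : ∀ x : ℝ≥0∞, (x ^ (1 / 2 : ℝ)) ^ 2 = x := fun x => by
    rw [← ENNReal.rpow_two, ← ENNReal.rpow_mul]; norm_num
  calc (∑' i, f i * g i) ^ 2
      ≤ ((∑' i, f i ^ 2) ^ (1 / 2 : ℝ) * (∑' i, g i ^ 2) ^ (1 / 2 : ℝ)) ^ 2 := by gcongr
    _ = _ := by rw [mul_pow, hsq, hsq]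

/-- Weighted Cauchy–Schwarz: an operator with kernel `M` is controlled by the row sums of
`M² / W` and the `W`-weighted square sum of its argument. -/
theorem tsum_weight_mul_sq_le {ι : Type*} (τ : ℝ) (M G W : ℤ → ι → ℝ) (hM : ∀ k i, 0 ≤ M k i)
    (hG : ∀ k i, 0 ≤ G k i) (hW : ∀ k i, 0 < W k i) (C : ℝ≥0∞)
    (hC : ∀ k, ∑' i, ENNReal.ofReal (jb k ^ τ * M k i ^ 2 / W k i) ≤ C) :
    ∑' k, ENNReal.ofReal (jb k ^ τ) * (∑' i, ENNReal.ofReal (M k i * G k i)) ^ 2 ≤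
      C * ∑' k, ∑' i, ENNReal.ofReal (W k i * G k i ^ 2) := by
  rw [← ENNReal.tsum_mul_left]
  refine ENNReal.tsum_le_tsum fun k => ?_
  have hk : 0 ≤ jb k ^ τ := by have := jb_pos k; positivity
  calc ENNReal.ofReal (jb k ^ τ) * (∑' i, ENNReal.ofReal (M k i * G k i)) ^ 2
      = ENNReal.ofReal (jb k ^ τ) * (∑' i, ENNReal.ofReal (M k i / √(W k i)) *
          ENNReal.ofReal (√(W k i) * G k i)) ^ 2 := by
        congr 2
        refine tsum_congr fun i => ?_
        have := hW k i
        have := hM k i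
        rw [← ENNReal.ofReal_mul (by positivity)]
        congr 1
        field_simp
    _ ≤ ENNReal.ofReal (jb k ^ τ) * ((∑' i, ENNReal.ofReal (M k i / √(W k i)) ^ 2) *
          ∑' i, ENNReal.ofReal (√(W k i) * G k i) ^ 2) := by
        gcongr
        exact ENNReal.tsum_mul_sq_le _ _
    _ = (∑' i, ENNReal.ofReal (jb k ^ τ * M k i ^ 2 / W k i)) *
          ∑' i, ENNReal.ofReal (W k i * G k i ^ 2) := by
        rw [← mul_assoc]
        congr 1
        · rw [← ENNReal.tsum_mul_left]
          refine tsum_congr fun i => ?_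
          have := hM k i
          rw [← ENNReal.ofReal_pow (by positivity), ← ENNReal.ofReal_mul hk, div_pow,
            Real.sq_sqrt (hW k i).le, mul_div_assoc]
        · refine tsum_congr fun i => ?_
          have := hG k i
          rw [← ENNReal.ofReal_pow (by positivity), mul_pow, Real.sq_sqrt (hW k i).le]
    _ ≤ _ := by gcongr; exact hC k

theorem tsum_sub_shift (f : ℤ → ℝ≥0∞) (c : ℤ) : ∑' k, f (k - c) = ∑' k, f k :=
  (Equiv.subRight c).tsum_eq f

theorem tsum_cubic_le (f₁ f₂ f₃ f₄ f₅ : ℤ → ℝ≥0∞) :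
    ∑' k : ℤ, ∑' p : ℤ × ℤ, f₁ p.1 * f₂ p.1 * f₃ p.1 * f₄ p.2 * f₅ (k - p.1 - p.2) ≤
      (∑' n, f₁ n) * (∑' n, f₂ n) * (∑' n, f₃ n) * (∑' n, f₄ n) * ∑' n, f₅ n := by
  rw [ENNReal.tsum_comm, ENNReal.tsum_prod']
  simp only [ENNReal.tsum_mul_left, sub_sub, tsum_sub_shift, ENNReal.tsum_mul_right]
  gcongr
  calc ∑' a, f₁ a * f₂ a * f₃ a ≤ ∑' a, f₁ a * (∑' n, f₂ n) * (∑' n, f₃ n) := by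
        refine ENNReal.tsum_le_tsum fun a => ?_
        gcongr
        · exact ENNReal.le_tsum a
        · exact ENNReal.le_tsum a
    _ = _ := by rw [ENNReal.tsum_mul_right, ENNReal.tsum_mul_right]

theorem tsum_quintic_eq (f₁ f₂ f₃ f₄ f₅ : ℤ → ℝ≥0∞) :
    ∑' k : ℤ, ∑' q : ℤ × ℤ × ℤ × ℤ, f₁ q.2.2.1 * f₂ q.2.2.2 * f₃ (q.1 - q.2.2.1 - q.2.2.2) *
        f₄ q.2.1 * f₅ (k - q.1 - q.2.1) =
      (∑' n, f₁ n) * (∑' n, f₂ n) * (∑' n, f₃ n) * (∑' n, f₄ n) * ∑' n, f₅ n := by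
  rw [ENNReal.tsum_comm]
  simp only [ENNReal.tsum_mul_left, sub_sub, tsum_sub_shift, ENNReal.tsum_mul_right]
  congr 1
  rw [ENNReal.tsum_prod']
  simp only [ENNReal.tsum_prod']
  have : ∀ k₁ : ℤ, ∑' (k₂ : ℤ) (j₁ : ℤ) (j₂ : ℤ), f₁ j₁ * f₂ j₂ * f₃ (k₁ - (j₁ + j₂)) * f₄ k₂ =
      ∑' j : ℤ × ℤ, f₁ j.1 * f₂ j.2 * f₃ (k₁ - (j.1 + j.2)) * ∑' n, f₄ n := by
    intro k₁
    rw [ENNReal.tsum_mul_right, ENNReal.tsum_prod']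
    simp only [ENNReal.tsum_mul_right, ENNReal.tsum_mul_left]
  simp only [this]
  rw [ENNReal.tsum_comm]
  simp only [ENNReal.tsum_mul_right, ENNReal.tsum_mul_left, tsum_sub_shift]
  congr 2
  rw [ENNReal.tsum_prod']
  simp only [ENNReal.tsum_mul_right, ENNReal.tsum_mul_left]

theorem norm_prod_five_sub_sq_le (x₁ x₂ x₃ x₄ x₅ y₁ y₂ y₃ y₄ y₅ : ℂ)
    {D₁ D₂ D₃ D₄ D₅ U₁ U₂ U₃ U₄ U₅ : ℝ}
    (hd₁ : ‖x₁ - y₁‖ ^ 2 ≤ D₁) (hd₂ : ‖x₂ - y₂‖ ^ 2 ≤ D₂) (hd₃ : ‖x₃ - y₃‖ ^ 2 ≤ D₃)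
    (hd₄ : ‖x₄ - y₄‖ ^ 2 ≤ D₄) (hd₅ : ‖x₅ - y₅‖ ^ 2 ≤ D₅)
    (hx₂ : ‖x₂‖ ^ 2 ≤ U₂) (hx₃ : ‖x₃‖ ^ 2 ≤ U₃) (hx₄ : ‖x₄‖ ^ 2 ≤ U₄) (hx₅ : ‖x₅‖ ^ 2 ≤ U₅)
    (hy₁ : ‖y₁‖ ^ 2 ≤ U₁) (hy₂ : ‖y₂‖ ^ 2 ≤ U₂) (hy₃ : ‖y₃‖ ^ 2 ≤ U₃) (hy₄ : ‖y₄‖ ^ 2 ≤ U₄) :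
    ‖x₁ * x₂ * x₃ * x₄ * x₅ - y₁ * y₂ * y₃ * y₄ * y₅‖ ^ 2 ≤
      5 * (D₁ * U₂ * U₃ * U₄ * U₅ + U₁ * D₂ * U₃ * U₄ * U₅ + U₁ * U₂ * D₃ * U₄ * U₅ +
        U₁ * U₂ * U₃ * D₄ * U₅ + U₁ * U₂ * U₃ * U₄ * D₅) := by
  set a := (x₁ - y₁) * x₂ * x₃ * x₄ * x₅ with ha
  set b := y₁ * (x₂ - y₂) * x₃ * x₄ * x₅ with hb
  set c := y₁ * y₂ * (x₃ - y₃) * x₄ * x₅ with hc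
  set d := y₁ * y₂ * y₃ * (x₄ - y₄) * x₅ with hd
  set e := y₁ * y₂ * y₃ * y₄ * (x₅ - y₅) with he
  have hsum : x₁ * x₂ * x₃ * x₄ * x₅ - y₁ * y₂ * y₃ * y₄ * y₅ = a + b + c + d + e := by
    rw [ha, hb, hc, hd, he]; ring
  have hn : ‖a + b + c + d + e‖ ≤ ‖a‖ + ‖b‖ + ‖c‖ + ‖d‖ + ‖e‖ := by
    refine (norm_add_le _ _).trans ?_
    gcongr
    exact norm_add₄_le
  have hpos (x : ℂ) {r : ℝ} (h : ‖x‖ ^ 2 ≤ r) : 0 ≤ r := (sq_nonneg _).trans h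
  have := hpos _ hd₁
  have := hpos _ hd₂
  have := hpos _ hd₃
  have := hpos _ hd₄
  have := hpos _ hd₅
  have := hpos _ hx₂
  have := hpos _ hx₃
  have := hpos _ hx₄
  have := hpos _ hx₅
  have := hpos _ hy₁
  have ea : ‖a‖ ^ 2 ≤ D₁ * U₂ * U₃ * U₄ * U₅ := by
    rw [ha]; simp only [norm_mul, mul_pow]; gcongr
  have eb : ‖b‖ ^ 2 ≤ U₁ * D₂ * U₃ * U₄ * U₅ := by
    rw [hb]; simp only [norm_mul, mul_pow]; gcongr
  have ec : ‖c‖ ^ 2 ≤ U₁ * U₂ * D₃ * U₄ * U₅ := by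
    rw [hc]; simp only [norm_mul, mul_pow]; gcongr
  have ed : ‖d‖ ^ 2 ≤ U₁ * U₂ * U₃ * D₄ * U₅ := by
    rw [hd]; simp only [norm_mul, mul_pow]; gcongr
  have ee : ‖e‖ ^ 2 ≤ U₁ * U₂ * U₃ * U₄ * D₅ := by
    rw [he]; simp only [norm_mul, mul_pow]; gcongr
  rw [hsum]
  have h5 : (‖a‖ + ‖b‖ + ‖c‖ + ‖d‖ + ‖e‖) ^ 2 ≤
      5 * (‖a‖ ^ 2 + ‖b‖ ^ 2 + ‖c‖ ^ 2 + ‖d‖ ^ 2 + ‖e‖ ^ 2) := by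
    nlinarith [sq_nonneg (‖a‖ - ‖b‖), sq_nonneg (‖a‖ - ‖c‖), sq_nonneg (‖a‖ - ‖d‖),
      sq_nonneg (‖a‖ - ‖e‖), sq_nonneg (‖b‖ - ‖c‖), sq_nonneg (‖b‖ - ‖d‖), sq_nonneg (‖b‖ - ‖e‖),
      sq_nonneg (‖c‖ - ‖d‖), sq_nonneg (‖c‖ - ‖e‖), sq_nonneg (‖d‖ - ‖e‖)]
  have := pow_le_pow_left₀ (norm_nonneg _) hn 2
  linarith

theorem ofReal_weight_mul_le {w₁ w₂ w₃ w₄ w₅ D₁ D₂ D₃ D₄ D₅ U₁ U₂ U₃ U₄ U₅ g : ℝ}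
    (hw₁ : 0 ≤ w₁) (hw₂ : 0 ≤ w₂) (hw₃ : 0 ≤ w₃) (hw₄ : 0 ≤ w₄) (hw₅ : 0 ≤ w₅)
    (hD₁ : 0 ≤ D₁) (hD₂ : 0 ≤ D₂) (hD₃ : 0 ≤ D₃) (hD₄ : 0 ≤ D₄) (hD₅ : 0 ≤ D₅)
    (hU₁ : 0 ≤ U₁) (hU₂ : 0 ≤ U₂) (hU₃ : 0 ≤ U₃) (hU₄ : 0 ≤ U₄) (hU₅ : 0 ≤ U₅)
    (hg : g ≤ 5 * (D₁ * U₂ * U₃ * U₄ * U₅ + U₁ * D₂ * U₃ * U₄ * U₅ + U₁ * U₂ * D₃ * U₄ * U₅ +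
        U₁ * U₂ * U₃ * D₄ * U₅ + U₁ * U₂ * U₃ * U₄ * D₅)) :
    ENNReal.ofReal (w₁ * w₂ * w₃ * w₄ * w₅ * g) ≤
      5 * (ENNReal.ofReal (w₁ * D₁) * ENNReal.ofReal (w₂ * U₂) * ENNReal.ofReal (w₃ * U₃) *
            ENNReal.ofReal (w₄ * U₄) * ENNReal.ofReal (w₅ * U₅) +
          ENNReal.ofReal (w₁ * U₁) * ENNReal.ofReal (w₂ * D₂) * ENNReal.ofReal (w₃ * U₃) *
            ENNReal.ofReal (w₄ * U₄) * ENNReal.ofReal (w₅ * U₅) +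
          ENNReal.ofReal (w₁ * U₁) * ENNReal.ofReal (w₂ * U₂) * ENNReal.ofReal (w₃ * D₃) *
            ENNReal.ofReal (w₄ * U₄) * ENNReal.ofReal (w₅ * U₅) +
          ENNReal.ofReal (w₁ * U₁) * ENNReal.ofReal (w₂ * U₂) * ENNReal.ofReal (w₃ * U₃) *
            ENNReal.ofReal (w₄ * D₄) * ENNReal.ofReal (w₅ * U₅) +
          ENNReal.ofReal (w₁ * U₁) * ENNReal.ofReal (w₂ * U₂) * ENNReal.ofReal (w₃ * U₃) *
            ENNReal.ofReal (w₄ * U₄) * ENNReal.ofReal (w₅ * D₅)) := by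
  have e (a b c d f : ℝ) (ha : 0 ≤ a) (hb : 0 ≤ b) (hc : 0 ≤ c) (hd : 0 ≤ d) :
      ENNReal.ofReal a * ENNReal.ofReal b * ENNReal.ofReal c * ENNReal.ofReal d *
        ENNReal.ofReal f = ENNReal.ofReal (a * b * c * d * f) := by
    rw [← ENNReal.ofReal_mul ha, ← ENNReal.ofReal_mul (by positivity),
      ← ENNReal.ofReal_mul (by positivity), ← ENNReal.ofReal_mul (by positivity)]
  rw [e _ _ _ _ _ (by positivity) (by positivity) (by positivity) (by positivity),
    e _ _ _ _ _ (by positivity) (by positivity) (by positivity) (by positivity),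
    e _ _ _ _ _ (by positivity) (by positivity) (by positivity) (by positivity),
    e _ _ _ _ _ (by positivity) (by positivity) (by positivity) (by positivity),
    e _ _ _ _ _ (by positivity) (by positivity) (by positivity) (by positivity),
    ← ENNReal.ofReal_add (by positivity) (by positivity),
    ← ENNReal.ofReal_add (by positivity) (by positivity),
    ← ENNReal.ofReal_add (by positivity) (by positivity),
    ← ENNReal.ofReal_add (by positivity) (by positivity),
    show (5 : ℝ≥0∞) = ENNReal.ofReal 5 by simp, ← ENNReal.ofReal_mul (by positivity)]
  refine ENNReal.ofReal_le_ofReal ((mul_le_mul_of_nonneg_left hg (by positivity)).trans_eq ?_)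
  ring

/-- The square `∑_k ⟨k⟩ |v k|²` of the `H^{1/2}` norm. -/
noncomputable def hsum (v : ℤ → ℂ) : ℝ≥0∞ := ∑' n, ENNReal.ofReal (jb n * ‖v n‖ ^ 2)

theorem tsum_jb_mul_add (v w : ℤ → ℂ) :
    ∑' n, ENNReal.ofReal (jb n * (‖v n‖ ^ 2 + ‖w n‖ ^ 2)) = hsum v + hsum w := by
  rw [hsum, hsum, ← ENNReal.tsum_add]
  refine tsum_congr fun n => ?_
  have := jb_pos n
  rw [mul_add, ENNReal.ofReal_add (by positivity) (by positivity)]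

theorem tsum_quintic_diff_le (v w : ℤ → ℂ) :
    ∑' k : ℤ, ∑' q : ℤ × ℤ × ℤ × ℤ, ENNReal.ofReal
      (jb q.2.2.1 * jb q.2.2.2 * jb (q.1 - q.2.2.1 - q.2.2.2) * jb q.2.1 * jb (k - q.1 - q.2.1) *
        ‖v q.2.2.1 * v q.2.2.2 * v (q.1 - q.2.2.1 - q.2.2.2) * v q.2.1 * v (k - q.1 - q.2.1) -
          w q.2.2.1 * w q.2.2.2 * w (q.1 - q.2.2.1 - q.2.2.2) * w q.2.1 *
            w (k - q.1 - q.2.1)‖ ^ 2) ≤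
      25 * (hsum v + hsum w) ^ 4 * hsum (fun n => v n - w n) := by
  let D : ℤ → ℝ≥0∞ := fun n => ENNReal.ofReal (jb n * ‖v n - w n‖ ^ 2)
  let U : ℤ → ℝ≥0∞ := fun n => ENNReal.ofReal (jb n * (‖v n‖ ^ 2 + ‖w n‖ ^ 2))
  have hx (n : ℤ) : ‖v n‖ ^ 2 ≤ ‖v n‖ ^ 2 + ‖w n‖ ^ 2 := le_add_of_nonneg_right (sq_nonneg _)
  have hy (n : ℤ) : ‖w n‖ ^ 2 ≤ ‖v n‖ ^ 2 + ‖w n‖ ^ 2 := le_add_of_nonneg_left (sq_nonneg _)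
  have hU0 (n : ℤ) : 0 ≤ ‖v n‖ ^ 2 + ‖w n‖ ^ 2 := by positivity
  let P (f₁ f₂ f₃ f₄ f₅ : ℤ → ℝ≥0∞) (k : ℤ) (q : ℤ × ℤ × ℤ × ℤ) : ℝ≥0∞ :=
    f₁ q.2.2.1 * f₂ q.2.2.2 * f₃ (q.1 - q.2.2.1 - q.2.2.2) * f₄ q.2.1 * f₅ (k - q.1 - q.2.1)
  calc _ ≤ ∑' k : ℤ, ∑' q : ℤ × ℤ × ℤ × ℤ, 5 * (P D U U U U k q + P U D U U U k q +
          P U U D U U k q + P U U U D U k q + P U U U U D k q) := by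
        refine ENNReal.tsum_le_tsum fun k => ENNReal.tsum_le_tsum fun q => ?_
        exact ofReal_weight_mul_le (jb_pos _).le (jb_pos _).le (jb_pos _).le (jb_pos _).le
          (jb_pos _).le (sq_nonneg _) (sq_nonneg _) (sq_nonneg _) (sq_nonneg _) (sq_nonneg _)
          (hU0 _) (hU0 _) (hU0 _) (hU0 _) (hU0 _)
          (norm_prod_five_sub_sq_le _ _ _ _ _ _ _ _ _ _ le_rfl le_rfl le_rfl le_rfl le_rfl
            (hx _) (hx _) (hx _) (hx _) (hy _) (hy _) (hy _) (hy _))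
    _ = 25 * (∑' n, U n) ^ 4 * ∑' n, D n := by
        simp only [ENNReal.tsum_mul_left, ENNReal.tsum_add, P, tsum_quintic_eq]
        ring
    _ = _ := by rw [← tsum_jb_mul_add, hsum]

theorem tsum_cubic_diff_le (v w : ℤ → ℂ) :
    ∑' k : ℤ, ∑' p : ℤ × ℤ, ENNReal.ofReal
      (jb p.1 * jb p.1 * jb p.1 * jb p.2 * jb (k - p.1 - p.2) *
        ‖(‖v p.1‖ : ℂ) * ‖v p.1‖ * v p.1 * v p.2 * v (k - p.1 - p.2) -
          (‖w p.1‖ : ℂ) * ‖w p.1‖ * w p.1 * w p.2 * w (k - p.1 - p.2)‖ ^ 2) ≤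
      25 * (hsum v + hsum w) ^ 4 * hsum (fun n => v n - w n) := by
  let D : ℤ → ℝ≥0∞ := fun n => ENNReal.ofReal (jb n * ‖v n - w n‖ ^ 2)
  let U : ℤ → ℝ≥0∞ := fun n => ENNReal.ofReal (jb n * (‖v n‖ ^ 2 + ‖w n‖ ^ 2))
  have hx (n : ℤ) : ‖v n‖ ^ 2 ≤ ‖v n‖ ^ 2 + ‖w n‖ ^ 2 := le_add_of_nonneg_right (sq_nonneg _)
  have hy (n : ℤ) : ‖w n‖ ^ 2 ≤ ‖v n‖ ^ 2 + ‖w n‖ ^ 2 := le_add_of_nonneg_left (sq_nonneg _)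
  have hx' (n : ℤ) : ‖(‖v n‖ : ℂ)‖ ^ 2 ≤ ‖v n‖ ^ 2 + ‖w n‖ ^ 2 := by simp
  have hy' (n : ℤ) : ‖(‖w n‖ : ℂ)‖ ^ 2 ≤ ‖v n‖ ^ 2 + ‖w n‖ ^ 2 := by simp
  have hd (n : ℤ) : ‖(‖v n‖ : ℂ) - ‖w n‖‖ ^ 2 ≤ ‖v n - w n‖ ^ 2 := by
    rw [← Complex.ofReal_sub, Complex.norm_real, Real.norm_eq_abs]
    gcongr
    exact abs_norm_sub_norm_le _ _
  have hU0 (n : ℤ) : 0 ≤ ‖v n‖ ^ 2 + ‖w n‖ ^ 2 := by positivity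
  let P (f₁ f₂ f₃ f₄ f₅ : ℤ → ℝ≥0∞) (k : ℤ) (p : ℤ × ℤ) : ℝ≥0∞ :=
    f₁ p.1 * f₂ p.1 * f₃ p.1 * f₄ p.2 * f₅ (k - p.1 - p.2)
  have hP (f₁ f₂ f₃ f₄ f₅ : ℤ → ℝ≥0∞) : ∑' k, ∑' p, P f₁ f₂ f₃ f₄ f₅ k p ≤
      (∑' n, f₁ n) * (∑' n, f₂ n) * (∑' n, f₃ n) * (∑' n, f₄ n) * ∑' n, f₅ n :=
    tsum_cubic_le f₁ f₂ f₃ f₄ f₅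
  calc _ ≤ ∑' k : ℤ, ∑' p : ℤ × ℤ, 5 * (P D U U U U k p + P U D U U U k p +
          P U U D U U k p + P U U U D U k p + P U U U U D k p) := by
        refine ENNReal.tsum_le_tsum fun k => ENNReal.tsum_le_tsum fun p => ?_
        exact ofReal_weight_mul_le (jb_pos _).le (jb_pos _).le (jb_pos _).le (jb_pos _).le
          (jb_pos _).le (sq_nonneg _) (sq_nonneg _) (sq_nonneg _) (sq_nonneg _) (sq_nonneg _)
          (hU0 _) (hU0 _) (hU0 _) (hU0 _) (hU0 _)
          (norm_prod_five_sub_sq_le _ _ _ _ _ _ _ _ _ _ (hd _) (hd _) le_rfl le_rfl le_rfl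
            (hx' _) (hx _) (hx _) (hx _) (hy' _) (hy' _) (hy _) (hy _))
    _ ≤ 25 * (∑' n, U n) ^ 4 * ∑' n, D n := by
        simp only [ENNReal.tsum_mul_left, ENNReal.tsum_add]
        refine (mul_le_mul' le_rfl (add_le_add (add_le_add (add_le_add (add_le_add
          (hP _ _ _ _ _) (hP _ _ _ _ _)) (hP _ _ _ _ _)) (hP _ _ _ _ _))
          (hP _ _ _ _ _))).trans_eq ?_
        ring
    _ = _ := by rw [← tsum_jb_mul_add, hsum]

theorem tsum_quintic_weight_le {τ p : ℝ} (h0 : 0 ≤ τ) (h1 : τ ≤ 1) (hp : p = (3 - τ) / 2)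
    (k : ℤ) :
    ∑' q : ℤ × ℤ × ℤ × ℤ, ENNReal.ofReal (jb k ^ τ * resMult k q.1 q.2.1 ^ 2 /
      (jb q.2.2.1 * jb q.2.2.2 * jb (q.1 - q.2.2.1 - q.2.2.2) * jb q.2.1 *
        jb (k - q.1 - q.2.1))) ≤
      311040 * (∑' n : ℤ, ENNReal.ofReal (jb n ^ (-p))) ^ 4 := by
  set S := (∑' n : ℤ, ENNReal.ofReal (jb n ^ (-p))) with hS
  have hk : 0 ≤ jb k ^ τ := by have := jb_pos k; positivity
  calc _ = ∑' (k₁ : ℤ) (k₂ : ℤ), ENNReal.ofReal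
          (jb k ^ τ * resMult k k₁ k₂ ^ 2 / (jb k₂ * jb (k - k₁ - k₂))) *
          ∑' j : ℤ × ℤ, ENNReal.ofReal (1 / (jb j.1 * jb j.2 * jb (k₁ - j.1 - j.2))) := by
        rw [ENNReal.tsum_prod']
        refine tsum_congr fun k₁ => ?_
        rw [ENNReal.tsum_prod']
        refine tsum_congr fun k₂ => ?_
        rw [← ENNReal.tsum_mul_left]
        refine tsum_congr fun j => ?_
        have a1 := jb_pos k₂
        have a2 := jb_pos (k - k₁ - k₂)
        have a3 := jb_pos j.1
        have a4 := jb_pos j.2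
        have a5 := jb_pos (k₁ - j.1 - j.2)
        rw [← ENNReal.ofReal_mul (by positivity)]
        congr 1
        field_simp
    _ ≤ ∑' (k₁ : ℤ) (k₂ : ℤ), ENNReal.ofReal
          (jb k ^ τ * resMult k k₁ k₂ ^ 2 / (jb k₂ * jb (k - k₁ - k₂))) *
          (9 * S ^ 2 * ENNReal.ofReal (jb k₁ ^ (-τ))) := by
        refine ENNReal.tsum_le_tsum fun k₁ => ENNReal.tsum_le_tsum fun k₂ => ?_
        gcongr
        exact tsum_inner_le h0 h1 hp k₁
    _ = 9 * S ^ 2 * ∑' q : ℤ × ℤ, ENNReal.ofReal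
          (jb k ^ τ * resMult k q.1 q.2 ^ 2 * jb q.1 ^ (-τ) / (jb q.2 * jb (k - q.1 - q.2))) := by
        rw [ENNReal.tsum_prod', ← ENNReal.tsum_mul_left]
        refine tsum_congr fun k₁ => ?_
        rw [← ENNReal.tsum_mul_left]
        refine tsum_congr fun k₂ => ?_
        have a1 := jb_pos k₂
        have a2 := jb_pos (k - k₁ - k₂)
        have a3 := jb_pos k₁
        rw [mul_left_comm, ← ENNReal.ofReal_mul (by positivity)]
        congr 2
        ring
    _ ≤ 9 * S ^ 2 * (34560 * S ^ 2) := by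
        gcongr
        exact tsum_resMult_le h0 h1 hp k
    _ = 311040 * S ^ 4 := by ring

theorem tsum_cubic_weight_le {τ p : ℝ} (h0 : 0 ≤ τ) (h1 : τ ≤ 1) (hp : p = (3 - τ) / 2)
    (k : ℤ) :
    ∑' q : ℤ × ℤ, ENNReal.ofReal (jb k ^ τ * resMult k q.1 q.2 ^ 2 /
      (jb q.1 * jb q.1 * jb q.1 * jb q.2 * jb (k - q.1 - q.2))) ≤
      34560 * (∑' n : ℤ, ENNReal.ofReal (jb n ^ (-p))) ^ 2 := by
  refine (ENNReal.tsum_le_tsum fun q => ENNReal.ofReal_le_ofReal ?_).trans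
    (tsum_resMult_le h0 h1 hp k)
  have a1 := jb_pos q.2
  have a2 := jb_pos (k - q.1 - q.2)
  have a3 := jb_pos q.1
  have a4 := jb_pos k
  have b3 := one_le_jb q.1
  have e : 1 / (jb q.1 * jb q.1 * jb q.1) ≤ jb q.1 ^ (-τ) := by
    rw [Real.rpow_neg a3.le, ← one_div]
    gcongr
    calc jb q.1 ^ τ ≤ jb q.1 ^ (1 : ℝ) := Real.rpow_le_rpow_of_exponent_le b3 h1
      _ = jb q.1 := Real.rpow_one _
      _ ≤ jb q.1 * jb q.1 * jb q.1 := by nlinarith [mul_pos a3 a3]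
  calc jb k ^ τ * resMult k q.1 q.2 ^ 2 /
      (jb q.1 * jb q.1 * jb q.1 * jb q.2 * jb (k - q.1 - q.2))
      = jb k ^ τ * resMult k q.1 q.2 ^ 2 * (1 / (jb q.1 * jb q.1 * jb q.1)) /
          (jb q.2 * jb (k - q.1 - q.2)) := by field_simp
    _ ≤ _ := by gcongr

theorem N2term1_eq_mul (t : ℝ) (k : ℤ) (p : ℤ × ℤ) :
    ∃ c : ℂ, ‖c‖ ≤ resMult k p.1 p.2 ∧ ∀ v : ℤ → ℂ, N2term1 v t k p =
      c * ((‖v p.1‖ : ℂ) * ‖v p.1‖ * v p.1 * v p.2 * v (k - p.1 - p.2)) := by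
  by_cases h : Phi p.1 p.2 (k - p.1 - p.2) ≠ 0
  · refine ⟨-(((k : ℂ) * (p.1 : ℂ)) / (Complex.I * ((Phi p.1 p.2 (k - p.1 - p.2) : ℤ) : ℂ))) *
      Complex.exp (Complex.I * (t : ℂ) * ((Phi p.1 p.2 (k - p.1 - p.2) : ℤ) : ℂ)), ?_, ?_⟩
    · have he : ‖Complex.exp (Complex.I * (t : ℂ) *
          ((Phi p.1 p.2 (k - p.1 - p.2) : ℤ) : ℂ))‖ = 1 := by
        rw [Complex.norm_exp]
        simp
      rw [norm_mul, he, resMult, if_pos h]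
      simp
    · intro v
      rw [N2term1, if_pos h]
      ring
  · refine ⟨0, by simpa using resMult_nonneg _ _ _, fun v => ?_⟩
    rw [N2term1, if_neg h, zero_mul]

theorem N2term2_eq_mul (t : ℝ) (k : ℤ) (q : ℤ × ℤ × ℤ × ℤ) :
    ∃ c : ℂ, ‖c‖ ≤ resMult k q.1 q.2.1 ∧ ∀ v : ℤ → ℂ, N2term2 v t k q =
      c * (v q.2.2.1 * v q.2.2.2 * v (q.1 - q.2.2.1 - q.2.2.2) * v q.2.1 *
        v (k - q.1 - q.2.1)) := by
  by_cases h : Phi q.1 q.2.1 (k - q.1 - q.2.1) ≠ 0 ∧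
      Phi q.2.2.1 q.2.2.2 (q.1 - q.2.2.1 - q.2.2.2) ≠ 0
  · refine ⟨(1 / 3 : ℂ) *
      (((k : ℂ) * (q.1 : ℂ)) / (Complex.I * ((Phi q.1 q.2.1 (k - q.1 - q.2.1) : ℤ) : ℂ))) *
      Complex.exp (Complex.I * (t : ℂ) *
        (((Phi q.1 q.2.1 (k - q.1 - q.2.1) : ℤ) : ℂ) +
          ((Phi q.2.2.1 q.2.2.2 (q.1 - q.2.2.1 - q.2.2.2) : ℤ) : ℂ))), ?_, ?_⟩
    · have he : ‖Complex.exp (Complex.I * (t : ℂ) *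
        (((Phi q.1 q.2.1 (k - q.1 - q.2.1) : ℤ) : ℂ) +
          ((Phi q.2.2.1 q.2.2.2 (q.1 - q.2.2.1 - q.2.2.2) : ℤ) : ℂ)))‖ = 1 := by
        rw [Complex.norm_exp]
        simp
      have hM : ‖((k : ℂ) * (q.1 : ℂ)) /
          (Complex.I * ((Phi q.1 q.2.1 (k - q.1 - q.2.1) : ℤ) : ℂ))‖ = resMult k q.1 q.2.1 := by
        rw [resMult, if_pos h.1]
        simp
      rw [norm_mul, norm_mul, he, hM, mul_one]
      refine mul_le_of_le_one_left (resMult_nonneg _ _ _) ?_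
      norm_num
    · intro v
      rw [N2term2, if_pos h]
      ring
  · refine ⟨0, by simpa using resMult_nonneg _ _ _, fun v => ?_⟩
    rw [N2term2, if_neg h, zero_mul]

/-- The constant in the estimates at the squared level, finite for `p > 1`. -/
noncomputable def sqConst (p : ℝ) : ℝ≥0∞ :=
  25 * (34560 * (∑' n : ℤ, ENNReal.ofReal (jb n ^ (-p))) ^ 2 +
    311040 * (∑' n : ℤ, ENNReal.ofReal (jb n ^ (-p))) ^ 4)

theorem tsum_N2term1_sub_le {τ p : ℝ} (h0 : 0 ≤ τ) (h1 : τ ≤ 1) (hp : p = (3 - τ) / 2)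
    (t : ℝ) (v w : ℤ → ℂ) :
    ∑' k, ENNReal.ofReal (jb k ^ τ) * (∑' q, ‖N2term1 v t k q - N2term1 w t k q‖ₑ) ^ 2 ≤
      sqConst p * ((hsum v + hsum w) ^ 4 * hsum (fun n => v n - w n)) := by
  have hbound := tsum_weight_mul_sq_le τ (fun k (q : ℤ × ℤ) => resMult k q.1 q.2)
    (fun k q => ‖(‖v q.1‖ : ℂ) * ‖v q.1‖ * v q.1 * v q.2 * v (k - q.1 - q.2) -
      (‖w q.1‖ : ℂ) * ‖w q.1‖ * w q.1 * w q.2 * w (k - q.1 - q.2)‖)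
    (fun k q => jb q.1 * jb q.1 * jb q.1 * jb q.2 * jb (k - q.1 - q.2))
    (fun _ _ => resMult_nonneg _ _ _) (fun _ _ => norm_nonneg _)
    (fun k q => by
      have := jb_pos q.1
      have := jb_pos q.2
      have := jb_pos (k - q.1 - q.2)
      positivity) _ (tsum_cubic_weight_le h0 h1 hp)
  calc _ ≤ _ := by
        refine ENNReal.tsum_le_tsum fun k => ?_
        gcongr with q
        obtain ⟨c, hc, hv⟩ := N2term1_eq_mul t k q
        rw [hv, hv, ← mul_sub, ← ofReal_norm, norm_mul]
        exact ENNReal.ofReal_le_ofReal (mul_le_mul_of_nonneg_right hc (norm_nonneg _))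
    _ ≤ _ := hbound
    _ ≤ 34560 * (∑' n : ℤ, ENNReal.ofReal (jb n ^ (-p))) ^ 2 *
          (25 * (hsum v + hsum w) ^ 4 * hsum (fun n => v n - w n)) := by
        gcongr
        exact tsum_cubic_diff_le v w
    _ = 25 * (34560 * (∑' n : ℤ, ENNReal.ofReal (jb n ^ (-p))) ^ 2) *
          ((hsum v + hsum w) ^ 4 * hsum (fun n => v n - w n)) := by ring
    _ ≤ _ := by
        unfold sqConst
        gcongr
        exact le_self_add

theorem tsum_N2term2_sub_le {τ p : ℝ} (h0 : 0 ≤ τ) (h1 : τ ≤ 1) (hp : p = (3 - τ) / 2)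
    (t : ℝ) (v w : ℤ → ℂ) :
    ∑' k, ENNReal.ofReal (jb k ^ τ) * (∑' q, ‖N2term2 v t k q - N2term2 w t k q‖ₑ) ^ 2 ≤
      sqConst p * ((hsum v + hsum w) ^ 4 * hsum (fun n => v n - w n)) := by
  have hbound := tsum_weight_mul_sq_le τ (fun k (q : ℤ × ℤ × ℤ × ℤ) => resMult k q.1 q.2.1)
    (fun k q => ‖v q.2.2.1 * v q.2.2.2 * v (q.1 - q.2.2.1 - q.2.2.2) * v q.2.1 *
        v (k - q.1 - q.2.1) -
      w q.2.2.1 * w q.2.2.2 * w (q.1 - q.2.2.1 - q.2.2.2) * w q.2.1 * w (k - q.1 - q.2.1)‖)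
    (fun k q => jb q.2.2.1 * jb q.2.2.2 * jb (q.1 - q.2.2.1 - q.2.2.2) * jb q.2.1 *
      jb (k - q.1 - q.2.1))
    (fun _ _ => resMult_nonneg _ _ _) (fun _ _ => norm_nonneg _)
    (fun k q => by
      have := jb_pos q.2.2.1
      have := jb_pos q.2.2.2
      have := jb_pos (q.1 - q.2.2.1 - q.2.2.2)
      have := jb_pos q.2.1
      have := jb_pos (k - q.1 - q.2.1)
      positivity) _ (tsum_quintic_weight_le h0 h1 hp)
  calc _ ≤ _ := by
        refine ENNReal.tsum_le_tsum fun k => ?_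
        gcongr with q
        obtain ⟨c, hc, hv⟩ := N2term2_eq_mul t k q
        rw [hv, hv, ← mul_sub, ← ofReal_norm, norm_mul]
        exact ENNReal.ofReal_le_ofReal (mul_le_mul_of_nonneg_right hc (norm_nonneg _))
    _ ≤ _ := hbound
    _ ≤ 311040 * (∑' n : ℤ, ENNReal.ofReal (jb n ^ (-p))) ^ 4 *
          (25 * (hsum v + hsum w) ^ 4 * hsum (fun n => v n - w n)) := by
        gcongr
        exact tsum_quintic_diff_le v w
    _ = 25 * (311040 * (∑' n : ℤ, ENNReal.ofReal (jb n ^ (-p))) ^ 4) *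
          ((hsum v + hsum w) ^ 4 * hsum (fun n => v n - w n)) := by ring
    _ ≤ _ := by
        unfold sqConst
        gcongr
        exact le_add_self

theorem sqConst_lt_top {p : ℝ} (hp : 1 < p) : sqConst p < ⊤ := by
  have h := tsum_jb_rpow_lt_top hp
  unfold sqConst
  finiteness

theorem hsum_eq_hnorm_sq (v : ℤ → ℂ) : hsum v = hnorm (1 / 2) v ^ 2 := by
  rw [hnorm, ← ENNReal.rpow_two, ← ENNReal.rpow_mul]
  norm_num [hsum]

theorem hsum_zero : hsum (fun _ => 0) = 0 := by simp [hsum]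

theorem N2term1_zero (t : ℝ) (k : ℤ) (p : ℤ × ℤ) : N2term1 (fun _ => 0) t k p = 0 := by
  simp [N2term1]

theorem N2term2_zero (t : ℝ) (k : ℤ) (q : ℤ × ℤ × ℤ × ℤ) : N2term2 (fun _ => 0) t k q = 0 := by
  simp [N2term2]

theorem ne_top_of_tsum_weight_mul_sq {τ : ℝ} {x : ℤ → ℝ≥0∞}
    (h : ∑' k, ENNReal.ofReal (jb k ^ τ) * x k ^ 2 ≠ ⊤) (k : ℤ) : x k ≠ ⊤ := by
  intro hk
  have hpos : ENNReal.ofReal (jb k ^ τ) ≠ 0 := by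
    have := jb_pos k
    rw [ENNReal.ofReal_ne_zero_iff]
    positivity
  refine ENNReal.ne_top_of_tsum_ne_top h k ?_
  rw [hk, ENNReal.top_pow two_ne_zero, ENNReal.mul_top hpos]

theorem sqConst_mul_hsum_ne_top {p : ℝ} (hp : 1 < p) {v : ℤ → ℂ} (hv : hsum v ≠ ⊤) :
    sqConst p * ((hsum v + hsum (fun _ => 0)) ^ 4 * hsum (fun n => v n - 0)) ≠ ⊤ := by
  have h := sqConst_lt_top hp
  simp only [hsum_zero, sub_zero]
  finiteness

theorem summable_N2term1 {v : ℤ → ℂ} (hv : hsum v ≠ ⊤) (t : ℝ) (k : ℤ) :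
    Summable (N2term1 v t k) := by
  have h := ne_top_of_le_ne_top (sqConst_mul_hsum_ne_top (p := (3 - 0) / 2) (by norm_num) hv)
    (tsum_N2term1_sub_le le_rfl zero_le_one rfl t v (fun _ => 0))
  simp only [N2term1_zero, sub_zero] at h
  exact Summable.of_enorm (ne_top_of_tsum_weight_mul_sq h k)

theorem summable_N2term2 {v : ℤ → ℂ} (hv : hsum v ≠ ⊤) (t : ℝ) (k : ℤ) :
    Summable (N2term2 v t k) := by
  have h := ne_top_of_le_ne_top (sqConst_mul_hsum_ne_top (p := (3 - 0) / 2) (by norm_num) hv)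
    (tsum_N2term2_sub_le le_rfl zero_le_one rfl t v (fun _ => 0))
  simp only [N2term2_zero, sub_zero] at h
  exact Summable.of_enorm (ne_top_of_tsum_weight_mul_sq h k)

theorem ENNReal.add_sq_le_two_mul (a b : ℝ≥0∞) : (a + b) ^ 2 ≤ 2 * a ^ 2 + 2 * b ^ 2 := by
  have := ENNReal.rpow_add_le_mul_rpow_add_rpow a b (p := 2) (by norm_num)
  norm_num at this
  rwa [mul_add] at this

theorem tsum_N2_sub_le {s τ p : ℝ} (hs : 2 * s ≤ τ) (h0 : 0 ≤ τ) (h1 : τ ≤ 1)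
    (hp : p = (3 - τ) / 2) (t : ℝ) {v w : ℤ → ℂ} (hv : hsum v ≠ ⊤) (hw : hsum w ≠ ⊤) :
    ∑' k, ENNReal.ofReal (jb k ^ (2 * s) * ‖N2 v t k - N2 w t k‖ ^ 2) ≤
      4 * sqConst p * ((hsum v + hsum w) ^ 4 * hsum (fun n => v n - w n)) := by
  calc _ ≤ ∑' k, (2 * (ENNReal.ofReal (jb k ^ τ) *
            (∑' q, ‖N2term1 v t k q - N2term1 w t k q‖ₑ) ^ 2) +
          2 * (ENNReal.ofReal (jb k ^ τ) *
            (∑' q, ‖N2term2 v t k q - N2term2 w t k q‖ₑ) ^ 2)) := by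
        refine ENNReal.tsum_le_tsum fun k => ?_
        have hk := jb_pos k
        have hdiff : N2 v t k - N2 w t k = (∑' q, (N2term1 v t k q - N2term1 w t k q)) +
            ∑' q, (N2term2 v t k q - N2term2 w t k q) := by
          rw [(summable_N2term1 hv t k).tsum_sub (summable_N2term1 hw t k),
            (summable_N2term2 hv t k).tsum_sub (summable_N2term2 hw t k), N2, N2]
          ring
        rw [ENNReal.ofReal_mul (by positivity), ENNReal.ofReal_pow (norm_nonneg _),
          ofReal_norm, mul_left_comm, mul_left_comm (2 : ℝ≥0∞), ← mul_add]
        gcongr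
        · exact one_le_jb k
        · rw [hdiff]
          refine le_trans ?_ (ENNReal.add_sq_le_two_mul _ _)
          gcongr
          refine (enorm_add_le _ _).trans ?_
          gcongr <;> exact enorm_tsum_le_tsum_enorm
    _ ≤ 2 * (sqConst p * ((hsum v + hsum w) ^ 4 * hsum (fun n => v n - w n))) +
          2 * (sqConst p * ((hsum v + hsum w) ^ 4 * hsum (fun n => v n - w n))) := by
        rw [ENNReal.tsum_add, ENNReal.tsum_mul_left, ENNReal.tsum_mul_left]
        gcongr
        · exact tsum_N2term1_sub_le h0 h1 hp t v w
        · exact tsum_N2term2_sub_le h0 h1 hp t v w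
    _ = _ := by ring

/-- Estimates for `N₂` below the endpoint: for `s < 1/2`, `N₂` is controlled by the
`H^{1/2}` norm. -/
theorem N2_below_endpoint (s : ℝ) (hs : s < 1 / 2) :
    ∃ C > (0 : ℝ), ∀ t : ℝ, ∀ v w : ℤ → ℂ,
      hnorm (1 / 2) v < ⊤ → hnorm (1 / 2) w < ⊤ →
      hnorm s (fun k => N2 v t k) ≤ ENNReal.ofReal C * hnorm (1 / 2) v ^ 5 ∧
      hnorm s (fun k => N2 v t k - N2 w t k) ≤
        ENNReal.ofReal C * (hnorm (1 / 2) v + hnorm (1 / 2) w) ^ 4 *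
          hnorm (1 / 2) (fun k => v k - w k) := by
  set τ : ℝ := max (2 * s) 0 with hτ
  have hτ1 : τ < 1 := max_lt (by linarith) one_pos
  set p : ℝ := (3 - τ) / 2 with hp
  have hK : 4 * sqConst p ≠ ⊤ := by
    have := sqConst_lt_top (p := p) (by linarith)
    finiteness
  set K := (4 * sqConst p) ^ (1 / 2 : ℝ) with hKdef
  have hKtop : K ≠ ⊤ := ENNReal.rpow_ne_top_of_nonneg (by norm_num) hK
  have hKC : K ≤ ENNReal.ofReal (K.toReal + 1) := by
    rw [ENNReal.le_ofReal_iff_toReal_le hKtop (by positivity)]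
    linarith
  have main (t : ℝ) (v w : ℤ → ℂ) (hv : hnorm (1 / 2) v < ⊤) (hw : hnorm (1 / 2) w < ⊤) :
      hnorm s (fun k => N2 v t k - N2 w t k) ≤
        ENNReal.ofReal (K.toReal + 1) * (hnorm (1 / 2) v + hnorm (1 / 2) w) ^ 4 *
          hnorm (1 / 2) (fun k => v k - w k) := by
    have hv' : hsum v ≠ ⊤ := by rw [hsum_eq_hnorm_sq]; finiteness
    have hw' : hsum w ≠ ⊤ := by rw [hsum_eq_hnorm_sq]; finiteness
    have hle := tsum_N2_sub_le (le_max_left _ _) (le_max_right _ _) hτ1.le hp t hv' hw'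
    simp only [hsum_eq_hnorm_sq] at hle
    set a := hnorm (1 / 2) v
    set b := hnorm (1 / 2) w
    set d := hnorm (1 / 2) (fun k => v k - w k)
    have hab : (a ^ 2 + b ^ 2) ^ 4 * d ^ 2 ≤ ((a + b) ^ 4 * d) ^ 2 := by
      calc (a ^ 2 + b ^ 2) ^ 4 * d ^ 2 ≤ ((a + b) ^ 2) ^ 4 * d ^ 2 := by
            gcongr
            calc a ^ 2 + b ^ 2 ≤ a ^ 2 + b ^ 2 + 2 * a * b := le_self_add
              _ = (a + b) ^ 2 := by ring
        _ = _ := by ring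
    calc hnorm s (fun k => N2 v t k - N2 w t k)
        ≤ (4 * sqConst p * ((a + b) ^ 4 * d) ^ 2) ^ (1 / 2 : ℝ) := by
          unfold hnorm
          gcongr
          exact hle.trans (by gcongr)
      _ = K * ((a + b) ^ 4 * d) := by
          rw [ENNReal.mul_rpow_of_nonneg _ _ (by norm_num), ← ENNReal.rpow_two,
            ← ENNReal.rpow_mul]
          norm_num [hKdef]
      _ ≤ ENNReal.ofReal (K.toReal + 1) * ((a + b) ^ 4 * d) := by gcongr
      _ = _ := by ring
  refine ⟨K.toReal + 1, by positivity, fun t v w hv hw => ⟨?_, main t v w hv hw⟩⟩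
  have hzero : hnorm (1 / 2) (fun _ => 0) = 0 := by simp [hnorm]
  have h := main t v (fun _ => 0) hv (by rw [hzero]; exact ENNReal.zero_lt_top)
  have hN (k : ℤ) : N2 (fun _ => 0) t k = 0 := by simp [N2, N2term1_zero, N2term2_zero]
  simp only [hN, hzero, sub_zero, add_zero] at h
  exact h.trans_eq (by ring)
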